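/- arXiv:2402.04969 — 2 statements merged into one kernel-verified Lean document; each statement's English description precedes it below -/
import Mathlib

section
/- Let α ∈ (0, 1) and τ₀ > 0, and define τ(s) = τ₀ · E_α(−(s/τ₀)^α) / ((s/τ₀)^{α−1} E_{α,α}(−(s/τ₀)^α)) for s > 0. Then τ(s)/s → 1/α as s → +∞; equivalently, lim_{x→+∞} E_α(−x^α) / (x^α E_{α,α}(−x^α)) = 1/α. In particular τ(s) → +∞ as s → +∞ (i.e. the nonlinear relaxation time diverges as σ → 0). -/
/-- The two-parameter Mittag-Leffler function `E_{α,β}(x) = ∑ x ^ k / Γ(α k + β)`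
for real `x`. The classical Mittag-Leffler function is `E_α = E_{α,1}`. -/
noncomputable def mittagLeffler (α β : ℝ) (x : ℝ) : ℝ :=
  ∑' k : ℕ, x ^ k / Real.Gamma (α * k + β)

section

open MeasureTheory Set Filter Topology

lemma integrableOn_rpow_mul_exp_neg_half {s : ℝ} (hs : 1 < s) :
    IntegrableOn (fun x : ℝ => x ^ (s - 1) * Real.exp (-(1 / 2) * x)) (Ioi 0) := by
  have := integrableOn_rpow_mul_exp_neg_mul_rpow (s := s - 1) (p := 1) (b := 1 / 2)
    (by linarith) one_pos (by norm_num)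
  simpa using this

lemma norm_cpow_mul_exp_le {s x : ℝ} (hx : 0 < x) {r : ℂ} (hr : 1 / 2 < r.re) :
    ‖(x : ℂ) ^ ((s : ℂ) - 1) * Complex.exp (-(r * x))‖
      ≤ x ^ (s - 1) * Real.exp (-(1 / 2) * x) := by
  rw [norm_mul, Complex.norm_cpow_eq_rpow_re_of_pos hx, Complex.norm_exp]
  simp only [Complex.sub_re, Complex.ofReal_re, Complex.one_re, Complex.neg_re, Complex.re_mul_ofReal]
  gcongr
  nlinarith

lemma aestronglyMeasurable_cpow_mul_exp (s r : ℂ) :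
    AEStronglyMeasurable (fun x : ℝ => (x : ℂ) ^ (s - 1) * Complex.exp (-(r * x)))
      (volume.restrict (Ioi 0)) := by
  refine ContinuousOn.aestronglyMeasurable (fun x hx => ?_) measurableSet_Ioi
  refine ContinuousAt.continuousWithinAt (ContinuousAt.mul ?_ (by fun_prop))
  exact Complex.continuousAt_ofReal_cpow_const _ _ (Or.inr (ne_of_gt hx))

lemma integrableOn_cpow_mul_exp {s : ℝ} (hs : 1 < s) {r : ℂ} (hr : 1 / 2 < r.re) :
    IntegrableOn (fun x : ℝ => (x : ℂ) ^ ((s : ℂ) - 1) * Complex.exp (-(r * x))) (Ioi 0) := by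
  refine (integrableOn_rpow_mul_exp_neg_half hs).mono' (aestronglyMeasurable_cpow_mul_exp _ _) ?_
  filter_upwards [ae_restrict_mem measurableSet_Ioi] with x hx
  exact norm_cpow_mul_exp_le hx hr

lemma isOpen_half_lt_re : IsOpen {r : ℂ | 1 / 2 < r.re} :=
  isOpen_lt continuous_const Complex.continuous_re

/-- The Laplace transform of `x ^ (s - 1)` at a complex point. -/
lemma integral_cpow_mul_exp_neg_complex_mul_Ioi {s : ℝ} (hs : 1 < s) {r : ℂ} (hr : 1 / 2 < r.re) :
    ∫ x in Ioi (0 : ℝ), (x : ℂ) ^ ((s : ℂ) - 1) * Complex.exp (-(r * x))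
      = r ^ (-(s : ℂ)) * Complex.Gamma s := by
  have h1 : DifferentiableOn ℂ (fun r : ℂ =>
      ∫ x in Ioi (0 : ℝ), (x : ℂ) ^ ((s : ℂ) - 1) * Complex.exp (-(r * x)))
      {r : ℂ | 1 / 2 < r.re} := by
    intro r₀ hr₀
    refine DifferentiableAt.differentiableWithinAt ?_
    have hs' : 1 < s + 1 := by linarith
    refine (hasDerivAt_integral_of_dominated_loc_of_deriv_le
      (F := fun r (x : ℝ) => (x : ℂ) ^ ((s : ℂ) - 1) * Complex.exp (-(r * x)))
      (F' := fun r (x : ℝ) => -((x : ℂ) ^ (((s + 1 : ℝ) : ℂ) - 1) * Complex.exp (-(r * x))))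
      (isOpen_half_lt_re.mem_nhds hr₀)
      (Eventually.of_forall fun r => aestronglyMeasurable_cpow_mul_exp _ _)
      (integrableOn_cpow_mul_exp hs hr₀) (aestronglyMeasurable_cpow_mul_exp _ _).neg
      ?_ (integrableOn_rpow_mul_exp_neg_half hs') ?_).2.differentiableAt
    · filter_upwards [ae_restrict_mem measurableSet_Ioi] with x hx r hr
      rw [norm_neg]
      exact norm_cpow_mul_exp_le hx hr
    · filter_upwards [ae_restrict_mem measurableSet_Ioi] with x hx r hr
      have hx0 : (x : ℂ) ≠ 0 := by exact_mod_cast ne_of_gt hx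
      have : (x : ℂ) ^ (((s + 1 : ℝ) : ℂ) - 1) = (x : ℂ) ^ ((s : ℂ) - 1) * x := by
        rw [show ((s + 1 : ℝ) : ℂ) - 1 = ((s : ℂ) - 1) + 1 by push_cast; ring, Complex.cpow_add _ _ hx0,
          Complex.cpow_one]
      rw [this]
      have h := ((((hasDerivAt_id r).mul_const (x : ℂ)).neg).cexp).const_mul ((x : ℂ) ^ ((s : ℂ) - 1))
      refine h.congr_deriv ?_
      simp only [Pi.neg_apply, id_eq]
      ring
  have h2 : DifferentiableOn ℂ (fun r : ℂ => r ^ (-(s : ℂ)) * Complex.Gamma s)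
      {r : ℂ | 1 / 2 < r.re} := by
    intro r hr
    refine DifferentiableAt.differentiableWithinAt ?_
    refine DifferentiableAt.mul_const ?_ _
    refine differentiableAt_id.cpow_const (Or.inl ?_)
    exact lt_trans (by norm_num) hr
  have hconv : IsPreconnected {r : ℂ | 1 / 2 < r.re} :=
    (convex_halfSpace_re_gt _).isPreconnected
  refine (h1.analyticOnNhd isOpen_half_lt_re).eqOn_of_preconnected_of_frequently_eq
    (h2.analyticOnNhd isOpen_half_lt_re) hconv (z₀ := 1) (by norm_num) ?_ hr
  have ht : Tendsto (fun y : ℝ => (y : ℂ)) (𝓝[>] 1) (𝓝[≠] 1) := by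
    refine tendsto_nhdsWithin_iff.2 ⟨?_, ?_⟩
    · exact (Complex.continuous_ofReal.tendsto' 1 1 (by simp)).mono_left nhdsWithin_le_nhds
    · filter_upwards [self_mem_nhdsWithin] with y hy
      simpa using ne_of_gt hy
  refine ht.frequently (Eventually.frequently ?_)
  filter_upwards [self_mem_nhdsWithin] with y hy
  have hy0 : (0 : ℝ) < y := lt_trans one_pos hy
  rw [Complex.integral_cpow_mul_exp_neg_mul_Ioi (by simp; linarith) hy0, one_div,
    Complex.inv_cpow, Complex.cpow_neg]
  rw [Complex.arg_ofReal_of_nonneg hy0.le]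
  exact Real.pi_pos.ne

/-- The parametrization `w ↦ 1 + 2πiw` of the vertical line `Re t = 1`. -/
noncomputable def bromwichLine (w : ℝ) : ℂ := 1 + 2 * Real.pi * w * Complex.I

lemma bromwichLine_re (w : ℝ) : (bromwichLine w).re = 1 := by simp [bromwichLine]

lemma bromwichLine_im (w : ℝ) : (bromwichLine w).im = 2 * Real.pi * w := by simp [bromwichLine]

lemma bromwichLine_ne_zero (w : ℝ) : bromwichLine w ≠ 0 := fun h => by
  simpa [bromwichLine_re] using congrArg Complex.re h

lemma one_le_norm_bromwichLine (w : ℝ) : 1 ≤ ‖bromwichLine w‖ :=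
  (bromwichLine_re w).symm.le.trans (Complex.re_le_norm _)

lemma norm_bromwichLine (w : ℝ) : ‖bromwichLine w‖ = (1 + ‖2 * Real.pi * w‖ ^ 2) ^ ((1 : ℝ) / 2) := by
  rw [← Real.sqrt_eq_rpow, Complex.norm_def, Complex.normSq_apply, bromwichLine_re, bromwichLine_im,
    Real.norm_eq_abs, sq_abs]
  ring_nf

lemma continuous_bromwichLine_cpow (c : ℂ) : Continuous fun w => bromwichLine w ^ c := by
  refine continuous_iff_continuousAt.2 fun w => ?_
  refine ContinuousAt.cpow ?_ continuousAt_const (Or.inl ?_)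
  · unfold bromwichLine; fun_prop
  · rw [bromwichLine_re]; exact one_pos

lemma integrable_norm_bromwichLine_rpow {c : ℝ} (hc : 1 < c) :
    Integrable fun w => ‖bromwichLine w‖ ^ (-c) := by
  have h := (integrable_rpow_neg_one_add_norm_sq (E := ℝ) (μ := volume) (r := c)
    (by simpa using hc)).comp_mul_left' (R := 2 * Real.pi) (by positivity)
  refine h.congr (Eventually.of_forall fun w => ?_)
  simp only [norm_bromwichLine]
  rw [← Real.rpow_mul (by positivity)]
  congr 1; ring

lemma integrable_bromwichLine_cpow {c : ℝ} (hc : 1 < c) :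
    Integrable fun w => bromwichLine w ^ (-(c : ℂ)) := by
  refine (integrable_norm_bromwichLine_rpow hc).mono'
    (continuous_bromwichLine_cpow _).aestronglyMeasurable (Eventually.of_forall fun w => ?_)
  rw [← Complex.ofReal_neg, Complex.norm_cpow_real]

/-- Bromwich's integral for the reciprocal of the Gamma function. -/
lemma integral_exp_mul_bromwichLine_cpow {c : ℝ} (hc : 1 < c) :
    ∫ w, Complex.exp (bromwichLine w) * bromwichLine w ^ (-(c : ℂ)) = (Complex.Gamma c)⁻¹ := by
  have hG : Complex.Gamma c ≠ 0 := Complex.Gamma_ne_zero_of_re_pos (by simp; linarith)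
  set f : ℝ → ℂ := (Ioi (0 : ℝ)).indicator fun x => (x : ℂ) ^ ((c : ℂ) - 1) * Complex.exp (-(1 * x))
    with hf
  have hfi : Integrable f :=
    (integrable_indicator_iff measurableSet_Ioi).2 (integrableOn_cpow_mul_exp hc (by norm_num))
  have hF : FourierTransform.fourier f = fun w => bromwichLine w ^ (-(c : ℂ)) * Complex.Gamma c := by
    ext w
    rw [Real.fourier_real_eq_integral_exp_smul,
      ← integral_cpow_mul_exp_neg_complex_mul_Ioi hc (r := bromwichLine w)
        (by rw [bromwichLine_re]; norm_num), ← integral_indicator measurableSet_Ioi]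
    congr 1 with x
    by_cases hx : x ∈ Ioi (0 : ℝ)
    · simp only [hf, indicator_of_mem hx, smul_eq_mul]
      rw [mul_left_comm, ← Complex.exp_add]
      congr 2
      simp [bromwichLine]; ring
    · simp [hf, indicator_of_notMem hx]
  have hcont : ContinuousAt f 1 := by
    have : f =ᶠ[𝓝 1] fun x => (x : ℂ) ^ ((c : ℂ) - 1) * Complex.exp (-(1 * x)) := by
      filter_upwards [Ioi_mem_nhds (zero_lt_one (α := ℝ))] with x hx
      simp only [hf, indicator_of_mem hx]
    rw [continuousAt_congr this]
    exact (Complex.continuousAt_ofReal_cpow_const _ _ (Or.inr one_ne_zero)).mul (by fun_prop)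
  have key := hfi.fourierInv_fourier_eq
    (by rw [hF]; exact (integrable_bromwichLine_cpow hc).mul_const _) hcont
  rw [hF, Real.fourierInv_eq'] at key
  have hf1 : f 1 = Complex.exp (-1) := by simp [hf]
  rw [hf1] at key
  have h3 : ∫ w, Complex.exp (bromwichLine w) * bromwichLine w ^ (-(c : ℂ)) =
      Complex.exp 1 * (Complex.Gamma c)⁻¹ * ∫ w : ℝ, Complex.exp (↑(2 * Real.pi * inner ℝ w 1) * Complex.I) •
        (bromwichLine w ^ (-(c : ℂ)) * Complex.Gamma c) := by
    rw [← integral_const_mul]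
    congr 1 with w
    have : bromwichLine w = 1 + ↑(2 * Real.pi * inner ℝ w 1) * Complex.I := by
      simp [bromwichLine]
    conv_lhs => rw [this, Complex.exp_add, ← this]
    rw [smul_eq_mul]
    field_simp
  rw [h3, key, mul_right_comm, ← Complex.exp_add]
  simp

lemma norm_bromwichLine_cpow (c w : ℝ) : ‖bromwichLine w ^ (-(c : ℂ))‖ = ‖bromwichLine w‖ ^ (-c) := by
  rw [← Complex.ofReal_neg, Complex.norm_cpow_real]

lemma norm_bromwichLine_cpow_le_one {α : ℝ} (hα : 0 ≤ α) (w : ℝ) :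
    ‖bromwichLine w ^ (-(α : ℂ))‖ ≤ 1 := by
  rw [norm_bromwichLine_cpow]
  exact Real.rpow_le_one_of_one_le_of_nonpos (one_le_norm_bromwichLine w) (by linarith)

lemma norm_exp_bromwichLine (w : ℝ) : ‖Complex.exp (bromwichLine w)‖ = Real.exp 1 := by
  rw [Complex.norm_exp, bromwichLine_re]

lemma bromwichLine_cpow_ne_zero (c : ℂ) (w : ℝ) : bromwichLine w ^ c ≠ 0 :=
  fun h => bromwichLine_ne_zero w ((Complex.cpow_eq_zero_iff _ _).1 h).1

lemma cos_mul_pi_div_two_pos {α : ℝ} (hα : α ∈ Ioo (0 : ℝ) 1) : 0 < Real.cos (α * (Real.pi / 2)) := by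
  have := Real.pi_pos
  exact Real.cos_pos_of_mem_Ioo ⟨by nlinarith [hα.1], by nlinarith [hα.2]⟩

lemma cos_mul_norm_le_re_bromwichLine_cpow {α : ℝ} (hα : α ∈ Ioo (0 : ℝ) 1) (w : ℝ) :
    Real.cos (α * (Real.pi / 2)) * ‖bromwichLine w ^ (-(α : ℂ))‖ ≤ (bromwichLine w ^ (-(α : ℂ))).re := by
  rw [norm_bromwichLine_cpow, ← Complex.ofReal_neg, Complex.cpow_ofReal_re, mul_comm]
  refine mul_le_mul_of_nonneg_left ?_ (by positivity)
  have harg : |(bromwichLine w).arg| < Real.pi / 2 :=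
    Complex.abs_arg_lt_pi_div_two_iff.2 (Or.inl (by rw [bromwichLine_re]; exact one_pos))
  rw [← Real.cos_abs ((bromwichLine w).arg * -α), abs_mul, abs_neg, abs_of_pos hα.1, mul_comm]
  have hp := Real.pi_pos
  refine Real.cos_le_cos_of_nonneg_of_le_pi 
    (mul_nonneg (abs_nonneg _) hα.1.le) ?_ ?_
  · nlinarith [hα.2]
  · nlinarith [hα.1]

lemma re_bromwichLine_cpow_nonneg {α : ℝ} (hα : α ∈ Ioo (0 : ℝ) 1) (w : ℝ) :
    0 ≤ (bromwichLine w ^ (-(α : ℂ))).re :=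
  (mul_nonneg (cos_mul_pi_div_two_pos hα).le (norm_nonneg _)).trans
    (cos_mul_norm_le_re_bromwichLine_cpow hα w)

lemma inv_Gamma_le {A s : ℝ} (hA : 0 < A) (hs : 1 ≤ s) :
    (Real.Gamma s)⁻¹ ≤ Real.exp (2 * A) * A ^ (-s) := by
  have hs0 : 0 < s := by linarith
  have hG := Real.Gamma_pos_of_pos hs0
  have hint : IntegrableOn (fun x : ℝ => x ^ (s - 1) * Real.exp (-(A * x))) (Ioi 0) := by
    simpa using integrableOn_rpow_mul_exp_neg_mul_rpow (s := s - 1) (p := 1) (b := A)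
      (by linarith) one_pos hA
  have hsub : Ioc (1 : ℝ) 2 ⊆ Ioi 0 := fun x hx => lt_trans one_pos hx.1
  have h1 : Real.exp (-(2 * A)) ≤ ∫ x in Ioc (1 : ℝ) 2, x ^ (s - 1) * Real.exp (-(A * x)) := by
    have h : ∫ _ in Ioc (1 : ℝ) 2, Real.exp (-(2 * A)) = Real.exp (-(2 * A)) := by
      norm_num
    rw [← h]
    refine setIntegral_mono_on (integrableOn_const (by simp)) (hint.mono_set hsub)
      measurableSet_Ioc fun x hx => ?_
    have h2 : Real.exp (-(2 * A)) ≤ Real.exp (-(A * x)) := by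
      exact Real.exp_le_exp.2 (by nlinarith [hx.2])
    have h3 : 1 ≤ x ^ (s - 1) := Real.one_le_rpow hx.1.le (by linarith)
    exact h2.trans (le_mul_of_one_le_left (Real.exp_pos _).le h3)
  have h2 : ∫ x in Ioc (1 : ℝ) 2, x ^ (s - 1) * Real.exp (-(A * x)) ≤
      ∫ x in Ioi (0 : ℝ), x ^ (s - 1) * Real.exp (-(A * x)) := by
    refine setIntegral_mono_set hint ?_ hsub.eventuallyLE
    filter_upwards [ae_restrict_mem measurableSet_Ioi] with x hx
    have : (0 : ℝ) < x := hx
    simp only [Pi.zero_apply]; positivity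
  have h3 := h1.trans h2
  rw [Real.integral_rpow_mul_exp_neg_mul_Ioi hs0 hA, one_div, Real.inv_rpow hA.le,
    ← Real.rpow_neg hA.le, Real.exp_neg] at h3
  rw [inv_le_iff_one_le_mul₀ hG]
  rw [inv_le_iff_one_le_mul₀ (Real.exp_pos _)] at h3
  linarith

lemma summable_choose_mul_pow_div_Gamma {α c R : ℝ} (hα : 0 < α) (hc : 1 < c) (hR : 0 ≤ R) (m : ℕ) :
    Summable fun k : ℕ => ((k + m).choose m : ℝ) * R ^ k * (Real.Gamma (α * k + c))⁻¹ := by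
  set A : ℝ := (2 * R + 1) ^ α⁻¹ with hA
  have hA0 : 0 < A := by positivity
  have hAα : A ^ (-α) = (2 * R + 1)⁻¹ := by
    rw [hA, ← Real.rpow_mul (by positivity), mul_neg, inv_mul_cancel₀ hα.ne',
      Real.rpow_neg_one]
  have hr : ‖R / (2 * R + 1)‖ < 1 := by
    rw [Real.norm_of_nonneg (by positivity), div_lt_one (by positivity)]; linarith
  refine Summable.of_nonneg_of_le (fun k => ?_) (fun k => ?_)
    ((summable_choose_mul_geometric_of_norm_lt_one m hr).mul_right (Real.exp (2 * A) * A ^ (-c)))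
  · have : 0 < Real.Gamma (α * k + c) := Real.Gamma_pos_of_pos (by positivity)
    positivity
  · have h : 1 ≤ α * k + c := by nlinarith [mul_nonneg hα.le (Nat.cast_nonneg (α := ℝ) k)]
    have e : A ^ (-(α * k + c)) = (2 * R + 1)⁻¹ ^ k * A ^ (-c) := by
      rw [← hAα, ← Real.rpow_mul_natCast hA0.le, ← Real.rpow_add hA0]
      congr 1; ring
    calc _ ≤ ((k + m).choose m : ℝ) * R ^ k * (Real.exp (2 * A) * A ^ (-(α * k + c))) := by
          gcongr; exact inv_Gamma_le hA0 h
      _ = _ := by rw [e, div_eq_mul_inv, mul_pow]; ring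

/-- The Prabhakar (three-parameter Mittag-Leffler) function with natural third parameter `m + 1`,
evaluated at `-z`. -/
noncomputable def prabhakar (α c : ℝ) (m : ℕ) (z : ℂ) : ℂ :=
  ∑' k : ℕ, ((k + m).choose m : ℂ) * (-z) ^ k * (Complex.Gamma (α * k + c : ℝ))⁻¹

lemma norm_prabhakar_term (α c : ℝ) (hα : 0 < α) (hc : 1 < c) (m k : ℕ) (z : ℂ) :
    ‖((k + m).choose m : ℂ) * (-z) ^ k * (Complex.Gamma (α * k + c : ℝ))⁻¹‖
      = ((k + m).choose m : ℝ) * ‖z‖ ^ k * (Real.Gamma (α * k + c))⁻¹ := by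
  have : 0 < Real.Gamma (α * k + c) := Real.Gamma_pos_of_pos (by positivity)
  rw [Complex.Gamma_ofReal, norm_mul, norm_mul, norm_pow, norm_neg, norm_inv, Complex.norm_natCast,
    Complex.norm_real, Real.norm_of_nonneg this.le]

lemma summable_prabhakar {α c : ℝ} (hα : 0 < α) (hc : 1 < c) (m : ℕ) (z : ℂ) :
    Summable fun k : ℕ => ((k + m).choose m : ℂ) * (-z) ^ k * (Complex.Gamma (α * k + c : ℝ))⁻¹ := by
  refine Summable.of_norm ?_
  simp only [norm_prabhakar_term α c hα hc]
  exact summable_choose_mul_pow_div_Gamma hα hc (norm_nonneg z) m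

lemma differentiable_prabhakar {α c : ℝ} (hα : 0 < α) (hc : 1 < c) (m : ℕ) :
    Differentiable ℂ (prabhakar α c m) := by
  intro z
  have h : DifferentiableOn ℂ (prabhakar α c m) (Metric.ball 0 (‖z‖ + 1)) := by
    refine Complex.differentiableOn_tsum_of_summable_norm
      (summable_choose_mul_pow_div_Gamma hα hc (R := ‖z‖ + 1) (by positivity) m)
      (fun k => by fun_prop) Metric.isOpen_ball fun k y hy => ?_
    rw [norm_prabhakar_term α c hα hc]
    have : 0 < Real.Gamma (α * k + c) := Real.Gamma_pos_of_pos (by positivity)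
    have := (mem_ball_zero_iff.1 hy).le
    gcongr
  exact h.differentiableAt (Metric.isOpen_ball.mem_nhds (by simp))

lemma prabhakar_eq_integral_of_norm_lt_one {α c : ℝ} (hα : 0 < α) (hc : 1 < c) (m : ℕ) {z : ℂ}
    (hz : ‖z‖ < 1) :
    prabhakar α c m z = ∫ w, Complex.exp (bromwichLine w) * bromwichLine w ^ (-(c : ℂ)) *
      (1 / (1 + z * bromwichLine w ^ (-(α : ℂ))) ^ (m + 1)) := by
  have hz' : ‖‖z‖‖ < 1 := by simpa
  have key := hasSum_integral_of_dominated_convergence (μ := volume)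
    (F := fun (k : ℕ) w => Complex.exp (bromwichLine w) * bromwichLine w ^ (-(c : ℂ)) *
      (((k + m).choose m : ℂ) * (-(z * bromwichLine w ^ (-(α : ℂ)))) ^ k))
    (f := fun w => Complex.exp (bromwichLine w) * bromwichLine w ^ (-(c : ℂ)) *
      (1 / (1 + z * bromwichLine w ^ (-(α : ℂ))) ^ (m + 1)))
    (fun k w => ((k + m).choose m : ℝ) * ‖z‖ ^ k * (Real.exp 1 * ‖bromwichLine w‖ ^ (-c)))
    ?_ ?_ ?_ ?_ ?_
  · rw [← key.tsum_eq, prabhakar]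
    congr 1 with k
    have hk : 1 < α * k + c := by nlinarith [mul_nonneg hα.le (Nat.cast_nonneg (α := ℝ) k)]
    rw [← integral_exp_mul_bromwichLine_cpow hk, ← integral_const_mul]
    congr 1 with w
    have e : bromwichLine w ^ (-((α * k + c : ℝ) : ℂ))
        = bromwichLine w ^ (-(c : ℂ)) * (bromwichLine w ^ (-(α : ℂ))) ^ k := by
      rw [← Complex.cpow_nat_mul, ← Complex.cpow_add _ _ (bromwichLine_ne_zero w)]
      congr 1; push_cast; ring
    rw [e, ← neg_mul, mul_pow]; ring
  · intro k
    have h1 := continuous_bromwichLine_cpow (-(c : ℂ))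
    have h2 := continuous_bromwichLine_cpow (-(α : ℂ))
    have h3 : Continuous bromwichLine := by unfold bromwichLine; fun_prop
    exact Continuous.aestronglyMeasurable (by fun_prop)
  · refine fun k => Eventually.of_forall fun w => ?_
    rw [norm_mul, norm_mul, norm_mul, norm_pow, norm_neg, norm_mul, norm_exp_bromwichLine,
      norm_bromwichLine_cpow, Complex.norm_natCast, mul_comm]
    have := norm_bromwichLine_cpow_le_one hα.le w
    gcongr
    exact mul_le_of_le_one_right (norm_nonneg _) this
  · exact Eventually.of_forall fun w =>
      (summable_choose_mul_geometric_of_norm_lt_one m hz').mul_right _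
  · simp only [tsum_mul_right]
    exact ((integrable_norm_bromwichLine_rpow hc).const_mul _).const_mul _
  · refine Eventually.of_forall fun w => ?_
    have hu : ‖-(z * bromwichLine w ^ (-(α : ℂ)))‖ < 1 := by
      rw [norm_neg, norm_mul]
      exact (mul_le_of_le_one_right (norm_nonneg _) (norm_bromwichLine_cpow_le_one hα.le w)).trans_lt hz
    simpa using (hasSum_choose_mul_geometric_of_norm_lt_one m hu).mul_left _

lemma half_le_norm_one_add_mul_bromwichLine_cpow {α : ℝ} (hα : α ∈ Ioo (0 : ℝ) 1) {z : ℂ}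
    (hz : 0 < z.re) (hz' : |z.im| < 1 / 2) (w : ℝ) :
    1 / 2 ≤ ‖1 + z * bromwichLine w ^ (-(α : ℂ))‖ := by
  refine le_trans ?_ (Complex.re_le_norm _)
  have h1 := re_bromwichLine_cpow_nonneg hα w
  have h2 : |(bromwichLine w ^ (-(α : ℂ))).im| ≤ 1 :=
    (Complex.abs_im_le_norm _).trans (norm_bromwichLine_cpow_le_one hα.1.le w)
  have h3 : |z.im * (bromwichLine w ^ (-(α : ℂ))).im| ≤ 1 / 2 := by
    rw [abs_mul]; nlinarith [abs_nonneg z.im]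
  have h4 := (abs_le.1 h3).2
  simp only [Complex.add_re, Complex.one_re, Complex.mul_re]
  nlinarith [mul_nonneg hz.le h1]

lemma continuous_bromwich_integrand {α : ℝ} (hα : α ∈ Ioo (0 : ℝ) 1) (c : ℂ) (n : ℕ) {z : ℂ}
    (hz : 0 < z.re) (hz' : |z.im| < 1 / 2) :
    Continuous fun w => Complex.exp (bromwichLine w) * bromwichLine w ^ c *
      (1 / (1 + z * bromwichLine w ^ (-(α : ℂ))) ^ n) := by
  have h1 := continuous_bromwichLine_cpow c
  have h2 := continuous_bromwichLine_cpow (-(α : ℂ))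
  have h3 : Continuous bromwichLine := by unfold bromwichLine; fun_prop
  refine (by fun_prop : Continuous fun w => Complex.exp (bromwichLine w) * bromwichLine w ^ c).mul
    (continuous_const.div (by fun_prop) fun w => pow_ne_zero _ ?_)
  have := half_le_norm_one_add_mul_bromwichLine_cpow hα hz hz' w
  exact norm_pos_iff.1 (by linarith)

lemma norm_bromwich_integrand_le {α : ℝ} (hα : α ∈ Ioo (0 : ℝ) 1) (c : ℝ) (n : ℕ) {z : ℂ}
    (hz : 0 < z.re) (hz' : |z.im| < 1 / 2) (w : ℝ) :
    ‖Complex.exp (bromwichLine w) * bromwichLine w ^ (-(c : ℂ)) *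
      (1 / (1 + z * bromwichLine w ^ (-(α : ℂ))) ^ n)‖
      ≤ Real.exp 1 * ‖bromwichLine w‖ ^ (-c) * 2 ^ n := by
  rw [norm_mul, norm_mul, norm_exp_bromwichLine, norm_bromwichLine_cpow, ← one_div_pow, norm_pow,
    norm_div, norm_one]
  have := half_le_norm_one_add_mul_bromwichLine_cpow hα hz hz' w
  gcongr
  rw [div_le_iff₀ (by linarith)]; linarith

lemma prabhakar_eq_integral {α c : ℝ} (hα : α ∈ Ioo (0 : ℝ) 1) (hc : 1 < c) (m : ℕ) {x : ℝ}
    (hx : 0 < x) :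
    prabhakar α c m x = ∫ w, Complex.exp (bromwichLine w) * bromwichLine w ^ (-(c : ℂ)) *
      (1 / (1 + x * bromwichLine w ^ (-(α : ℂ))) ^ (m + 1)) := by
  set U : Set ℂ := {z | 0 < z.re} ∩ {z | |z.im| < 1 / 2} with hU
  have hUo : IsOpen U := (isOpen_lt continuous_const Complex.continuous_re).inter
    (isOpen_lt (continuous_abs.comp Complex.continuous_im) continuous_const)
  have hUc : IsPreconnected U := by
    have : {z : ℂ | |z.im| < 1 / 2} = {z | -(1 / 2) < z.im} ∩ {z | z.im < 1 / 2} := by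
      ext z; simp [abs_lt]
    rw [hU, this]
    exact ((convex_halfSpace_re_gt _).inter
      ((convex_halfSpace_im_gt _).inter (convex_halfSpace_im_lt _))).isPreconnected
  have hd : DifferentiableOn ℂ (fun z : ℂ => ∫ w, Complex.exp (bromwichLine w) *
      bromwichLine w ^ (-(c : ℂ)) * (1 / (1 + z * bromwichLine w ^ (-(α : ℂ))) ^ (m + 1))) U := by
    intro z₀ hz₀
    refine DifferentiableAt.differentiableWithinAt ?_
    refine (hasDerivAt_integral_of_dominated_loc_of_deriv_le
      (F := fun (z : ℂ) w => Complex.exp (bromwichLine w) *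
        bromwichLine w ^ (-(c : ℂ)) * (1 / (1 + z * bromwichLine w ^ (-(α : ℂ))) ^ (m + 1)))
      (F' := fun (z : ℂ) w => -((m + 1 : ℕ) : ℂ) * bromwichLine w ^ (-(α : ℂ)) *
        (Complex.exp (bromwichLine w) *
        bromwichLine w ^ (-(c : ℂ)) * (1 / (1 + z * bromwichLine w ^ (-(α : ℂ))) ^ (m + 2))))
      (bound := fun w => (m + 1 : ℕ) * (Real.exp 1 * ‖bromwichLine w‖ ^ (-c) * 2 ^ (m + 2)))
      (hUo.mem_nhds hz₀) ?_ ?_ ?_ ?_ ?_ ?_).2.differentiableAt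
    · filter_upwards [hUo.mem_nhds hz₀] with z hz
      exact (continuous_bromwich_integrand hα _ _ hz.1 hz.2).aestronglyMeasurable
    · refine (((integrable_norm_bromwichLine_rpow hc).const_mul (Real.exp 1)).mul_const
        (2 ^ (m + 1))).mono'
        (continuous_bromwich_integrand hα _ _ hz₀.1 hz₀.2).aestronglyMeasurable
        (Eventually.of_forall fun w => ?_)
      exact norm_bromwich_integrand_le hα c (m + 1) hz₀.1 hz₀.2 w
    · exact ((continuous_const.mul (continuous_bromwichLine_cpow _)).mul
        (continuous_bromwich_integrand hα _ _ hz₀.1 hz₀.2)).aestronglyMeasurable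
    · refine Eventually.of_forall fun w z hz => ?_
      rw [norm_mul, norm_mul, norm_neg, Complex.norm_natCast]
      have h1 := norm_bromwich_integrand_le hα c (m + 2) hz.1 hz.2 w
      have h2 := norm_bromwichLine_cpow_le_one hα.1.le w
      gcongr
      exact mul_le_of_le_one_right (by positivity) h2
    · exact ((((integrable_norm_bromwichLine_rpow hc).const_mul (Real.exp 1)).mul_const
        (2 ^ (m + 2)))).const_mul _
    · refine Eventually.of_forall fun w z hz => ?_
      have h0 : 1 + z * bromwichLine w ^ (-(α : ℂ)) ≠ 0 := by
        have := half_le_norm_one_add_mul_bromwichLine_cpow hα hz.1 hz.2 w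
        exact norm_pos_iff.1 (by linarith)
      have h1 : HasDerivAt (fun z : ℂ => 1 + z * bromwichLine w ^ (-(α : ℂ)))
          (bromwichLine w ^ (-(α : ℂ))) z := by
        simpa using ((hasDerivAt_id z).mul_const (bromwichLine w ^ (-(α : ℂ)))).const_add 1
      have h2 := ((h1.pow (m + 1)).inv (pow_ne_zero _ h0)).const_mul
        (Complex.exp (bromwichLine w) * bromwichLine w ^ (-(c : ℂ)))
      simp only [one_div]
      refine h2.congr_deriv ?_
      simp only [Pi.pow_apply, Nat.add_sub_cancel]
      field_simp
      ring
  have hxU : (x : ℂ) ∈ U := by simp [hU, hx]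
  have h0 : ((1 / 2 : ℝ) : ℂ) ∈ U := by simp [hU]
  refine ((differentiable_prabhakar hα.1 hc m).differentiableOn.analyticOnNhd
    hUo).eqOn_of_preconnected_of_eventuallyEq (hd.analyticOnNhd hUo) hUc h0 ?_ hxU
  have : Metric.ball (0 : ℂ) 1 ∈ 𝓝 ((1 / 2 : ℝ) : ℂ) :=
    Metric.isOpen_ball.mem_nhds (by rw [mem_ball_zero_iff, Complex.norm_real]; norm_num)
  filter_upwards [this] with z hz
  exact prabhakar_eq_integral_of_norm_lt_one hα.1 hc m (mem_ball_zero_iff.1 hz)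

lemma max_le_norm_one_add_mul_bromwichLine_cpow {α : ℝ} (hα : α ∈ Ioo (0 : ℝ) 1) {x : ℝ}
    (hx : 0 < x) (w : ℝ) :
    max 1 (x * (Real.cos (α * (Real.pi / 2)) * ‖bromwichLine w‖ ^ (-α)))
      ≤ ‖1 + x * bromwichLine w ^ (-(α : ℂ))‖ := by
  refine le_trans ?_ (Complex.re_le_norm _)
  have h1 := re_bromwichLine_cpow_nonneg hα w
  have h2 := cos_mul_norm_le_re_bromwichLine_cpow hα w
  rw [norm_bromwichLine_cpow] at h2
  rw [Complex.add_re, Complex.one_re, Complex.re_ofReal_mul]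
  refine max_le ?_ ?_
  · nlinarith [mul_nonneg hx.le h1]
  · nlinarith [mul_le_mul_of_nonneg_left h2 hx.le]

/-- Asymptotics of the Prabhakar function on the negative half-line; the limit is nonzero exactly
when `q = 0`. -/
lemma tendsto_pow_mul_prabhakar {α c : ℝ} (hα : α ∈ Ioo (0 : ℝ) 1) (hc : 1 < c) {m p q : ℕ}
    (hpq : m + 1 = p + q) (hp : 1 < c - α * p) :
    Tendsto (fun x : ℝ => (x : ℂ) ^ p * prabhakar α c m x) atTop
      (𝓝 (0 ^ q * (Complex.Gamma (c - α * p : ℝ))⁻¹)) := by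
  set κ := Real.cos (α * (Real.pi / 2)) with hκ
  have hκ0 : 0 < κ := cos_mul_pi_div_two_pos hα
  have hlim : 0 ^ q * (Complex.Gamma (c - α * p : ℝ))⁻¹ =
      ∫ w, Complex.exp (bromwichLine w) * bromwichLine w ^ (-(c : ℂ)) *
        ((bromwichLine w ^ (-(α : ℂ)))⁻¹ ^ p * 0 ^ q) := by
    rw [← integral_exp_mul_bromwichLine_cpow hp, ← integral_const_mul]
    congr 1 with w
    have e : bromwichLine w ^ (-((c - α * p : ℝ) : ℂ))
        = bromwichLine w ^ (-(c : ℂ)) * ((bromwichLine w ^ (-(α : ℂ)))⁻¹) ^ p := by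
      rw [← Complex.cpow_neg, ← Complex.cpow_nat_mul,
        ← Complex.cpow_add _ _ (bromwichLine_ne_zero w)]
      congr 1; push_cast; ring
    rw [e]; ring
  have hrep : (fun x : ℝ => (x : ℂ) ^ p * prabhakar α c m x) =ᶠ[atTop] fun x : ℝ =>
      ∫ w, Complex.exp (bromwichLine w) * bromwichLine w ^ (-(c : ℂ)) *
        ((x / (1 + x * bromwichLine w ^ (-(α : ℂ)))) ^ p *
          (1 / (1 + x * bromwichLine w ^ (-(α : ℂ)))) ^ q) := by
    filter_upwards [eventually_gt_atTop 0] with x hx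
    rw [prabhakar_eq_integral hα hc m hx, ← integral_const_mul]
    congr 1 with w
    rw [hpq, pow_add, div_pow, div_pow, one_pow]
    ring
  rw [hlim]
  refine Tendsto.congr' hrep.symm ?_
  refine tendsto_integral_filter_of_dominated_convergence
    (fun w => Real.exp 1 * ‖bromwichLine w‖ ^ (-(c - α * p)) * κ⁻¹ ^ p) ?_ ?_
    (((integrable_norm_bromwichLine_rpow hp).const_mul _).mul_const _) ?_
  · filter_upwards [eventually_gt_atTop 0] with x hx
    have h := (continuous_bromwich_integrand hα (-(c : ℂ)) (m + 1) (z := x) (by simpa)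
      (by simp)).const_mul ((x : ℂ) ^ p)
    refine (h.congr fun w => ?_).aestronglyMeasurable
    rw [hpq, pow_add, div_pow, div_pow, one_pow]
    ring
  · filter_upwards [eventually_gt_atTop 0] with x hx
    refine Eventually.of_forall fun w => ?_
    have hb0 : 0 < ‖bromwichLine w‖ := one_pos.trans_le (one_le_norm_bromwichLine w)
    obtain ⟨h1, h2⟩ := max_le_iff.1 (max_le_norm_one_add_mul_bromwichLine_cpow hα hx w)
    have h3 : ‖(x : ℂ) / (1 + x * bromwichLine w ^ (-(α : ℂ)))‖ ≤ κ⁻¹ * ‖bromwichLine w‖ ^ α := by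
      rw [norm_div, Complex.norm_real, Real.norm_of_nonneg hx.le, div_le_iff₀ (by linarith)]
      refine le_trans (le_of_eq ?_) (mul_le_mul_of_nonneg_left h2 (by positivity))
      rw [← hκ, Real.rpow_neg hb0.le]
      field_simp
    have h4 : ‖1 / (1 + x * bromwichLine w ^ (-(α : ℂ)))‖ ≤ 1 := by
      rw [norm_div, norm_one]; exact div_le_one_of_le₀ h1 (norm_nonneg _)
    have e : ‖bromwichLine w‖ ^ (-(c - α * p))
        = ‖bromwichLine w‖ ^ (-c) * (‖bromwichLine w‖ ^ α) ^ p := by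
      rw [← Real.rpow_mul_natCast hb0.le, ← Real.rpow_add hb0]
      congr 1; ring
    rw [norm_mul, norm_mul, norm_mul, norm_pow, norm_pow, norm_exp_bromwichLine,
      norm_bromwichLine_cpow, e]
    calc _ ≤ Real.exp 1 * ‖bromwichLine w‖ ^ (-c) * ((κ⁻¹ * ‖bromwichLine w‖ ^ α) ^ p * 1 ^ q) := by
          gcongr
      _ = _ := by rw [mul_pow, one_pow]; ring
  · refine Eventually.of_forall fun w => ?_
    have hu := bromwichLine_cpow_ne_zero (-(α : ℂ)) w
    have hinv : Tendsto (fun x : ℝ => (x : ℂ)⁻¹) atTop (𝓝 0) := by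
      have := (Complex.continuous_ofReal.tendsto 0).comp tendsto_inv_atTop_zero
      simpa [Function.comp_def] using this
    have h1 : Tendsto (fun x : ℝ => (x : ℂ) / (1 + x * bromwichLine w ^ (-(α : ℂ)))) atTop
        (𝓝 (bromwichLine w ^ (-(α : ℂ)))⁻¹) := by
      have h := (hinv.add_const (bromwichLine w ^ (-(α : ℂ)))).inv₀ (by simpa using hu)
      rw [zero_add] at h
      refine h.congr' ?_
      filter_upwards [eventually_gt_atTop 0] with x hx
      have hx0 : (x : ℂ) ≠ 0 := by exact_mod_cast hx.ne'
      rw [inv_eq_one_div, show (x : ℂ)⁻¹ + bromwichLine w ^ (-(α : ℂ))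
        = (1 + x * bromwichLine w ^ (-(α : ℂ))) / x by field_simp, one_div_div]
    have h2 : Tendsto (fun x : ℝ => 1 / (1 + x * bromwichLine w ^ (-(α : ℂ)))) atTop (𝓝 0) := by
      have h := h1.mul hinv
      rw [mul_zero] at h
      refine h.congr' ?_
      filter_upwards [eventually_gt_atTop 0] with x hx
      have hx0 : (x : ℂ) ≠ 0 := by exact_mod_cast hx.ne'
      field_simp
    exact ((h1.pow p).mul (h2.pow q)).const_mul _

lemma ofReal_mittagLeffler_one {α : ℝ} (hα : 0 < α) (x : ℝ) :
    ((mittagLeffler α 1 (-x) : ℝ) : ℂ)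
      = α * prabhakar α 2 1 x + (1 - α) * prabhakar α 2 0 x := by
  rw [mittagLeffler, Complex.ofReal_tsum, prabhakar, prabhakar, ← tsum_mul_left, ← tsum_mul_left,
    ← ((summable_prabhakar hα one_lt_two 1 x).mul_left _).tsum_add
      ((summable_prabhakar hα one_lt_two 0 x).mul_left _)]
  congr 1 with k
  have hk : 0 < α * k + 1 := by positivity
  have hG : (Real.Gamma (α * k + 1) : ℂ) ≠ 0 := by
    exact_mod_cast (Real.Gamma_pos_of_pos hk).ne'
  have hk' : (α * k + 1 : ℂ) ≠ 0 := by exact_mod_cast hk.ne'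
  rw [show α * (k : ℝ) + 2 = α * k + 1 + 1 by ring, Complex.Gamma_ofReal,
    Real.Gamma_add_one hk.ne']
  simp only [Nat.choose_one_right, add_zero, Nat.choose_zero_right]
  push_cast
  field_simp
  ring

lemma ofReal_mittagLeffler_self {α : ℝ} (hα : 0 < α) (x : ℝ) :
    ((mittagLeffler α α (-x) : ℝ) : ℂ)
      = 2 * α ^ 2 * prabhakar α (α + 2) 2 x + α * (1 - α) * prabhakar α (α + 2) 1 x := by
  have hc : 1 < α + 2 := by linarith
  rw [mittagLeffler, Complex.ofReal_tsum, prabhakar, prabhakar, ← tsum_mul_left, ← tsum_mul_left,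
    ← ((summable_prabhakar hα hc 2 x).mul_left _).tsum_add
      ((summable_prabhakar hα hc 1 x).mul_left _)]
  congr 1 with k
  have hk : 0 < α * (k + 1) := by positivity
  have hG : (Real.Gamma (α * (k + 1)) : ℂ) ≠ 0 := by
    exact_mod_cast (Real.Gamma_pos_of_pos hk).ne'
  have hα0 : (α : ℂ) ≠ 0 := by exact_mod_cast hα.ne'
  have hk1 : (k + 1 : ℂ) ≠ 0 := Nat.cast_add_one_ne_zero k
  have hk2 : (α * (k + 1) + 1 : ℂ) ≠ 0 := by exact_mod_cast (by positivity : 0 < α * (k + 1) + 1).ne'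
  rw [show α * (k : ℝ) + (α + 2) = α * (k + 1) + 1 + 1 by ring,
    show α * (k : ℝ) + α = α * (k + 1) by ring, Complex.Gamma_ofReal,
    Real.Gamma_add_one (by positivity), Real.Gamma_add_one hk.ne', Nat.cast_choose_two]
  simp only [Nat.choose_one_right]
  push_cast
  field_simp
  ring

lemma tendsto_mul_mittagLeffler_one {α : ℝ} (hα : α ∈ Ioo (0 : ℝ) 1) :
    Tendsto (fun x : ℝ => x * mittagLeffler α 1 (-x)) atTop
      (𝓝 ((1 - α) * (Real.Gamma (2 - α))⁻¹)) := by
  have hp : 1 < 2 - α * ((1 : ℕ) : ℝ) := by push_cast; linarith [hα.2]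
  have h1 := tendsto_pow_mul_prabhakar hα one_lt_two (m := 1) (p := 1) (q := 1) rfl hp
  have h0 := tendsto_pow_mul_prabhakar hα one_lt_two (m := 0) (p := 1) (q := 0) rfl hp
  have h := (Complex.continuous_re.tendsto _).comp
    ((h1.const_mul (α : ℂ)).add (h0.const_mul (1 - α : ℂ)))
  convert h using 1
  · ext x
    rw [Function.comp_apply, ← Complex.ofReal_re (x * _), Complex.ofReal_mul,
      ofReal_mittagLeffler_one hα.1]
    congr 1; ring
  · rw [Complex.Gamma_ofReal]
    congr 1
    rw [← Complex.ofReal_re ((1 - α) * _)]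
    congr 1
    push_cast
    simp

lemma tendsto_sq_mul_mittagLeffler_self {α : ℝ} (hα : α ∈ Ioo (0 : ℝ) 1) :
    Tendsto (fun x : ℝ => x ^ 2 * mittagLeffler α α (-x)) atTop
      (𝓝 (α * ((1 - α) * (Real.Gamma (2 - α))⁻¹))) := by
  have hc : 1 < α + 2 := by linarith [hα.1]
  have hp : 1 < α + 2 - α * ((2 : ℕ) : ℝ) := by push_cast; linarith [hα.2]
  have h1 := tendsto_pow_mul_prabhakar hα hc (m := 2) (p := 2) (q := 1) rfl hp
  have h0 := tendsto_pow_mul_prabhakar hα hc (m := 1) (p := 2) (q := 0) rfl hp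
  have h := (Complex.continuous_re.tendsto _).comp
    ((h1.const_mul (2 * α ^ 2 : ℂ)).add (h0.const_mul (α * (1 - α) : ℂ)))
  convert h using 1
  · ext x
    rw [Function.comp_apply, ← Complex.ofReal_re (x ^ 2 * _), Complex.ofReal_mul,
      ofReal_mittagLeffler_self hα.1]
    congr 1; push_cast; ring
  · rw [Complex.Gamma_ofReal, show α + 2 - α * ((2 : ℕ) : ℝ) = 2 - α by push_cast; ring]
    congr 1
    rw [← Complex.ofReal_re (α * _)]
    congr 1
    push_cast
    simp [mul_assoc]

lemma tendsto_mittagLeffler_ratio {α : ℝ} (hα : α ∈ Ioo (0 : ℝ) 1) :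
    Tendsto (fun x : ℝ => mittagLeffler α 1 (-x) / (x * mittagLeffler α α (-x))) atTop
      (𝓝 (1 / α)) := by
  have hG : 0 < Real.Gamma (2 - α) := Real.Gamma_pos_of_pos (by linarith [hα.2])
  have hL : (1 - α) * (Real.Gamma (2 - α))⁻¹ ≠ 0 :=
    mul_ne_zero (by linarith [hα.2]) (inv_ne_zero hG.ne')
  have h := (tendsto_mul_mittagLeffler_one hα).div (tendsto_sq_mul_mittagLeffler_self hα)
    (mul_ne_zero hα.1.ne' hL)
  rw [div_mul_cancel_right₀ hL, ← one_div] at h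
  refine h.congr' ?_
  filter_upwards [eventually_gt_atTop 0] with x hx
  rw [Pi.div_apply, sq, mul_assoc, mul_div_mul_left _ _ hx.ne']

end

/-- Let `α ∈ (0,1)`, `τ₀ > 0`, and
`τ(s) = τ₀ E_α(-(s/τ₀)^α) / ((s/τ₀)^(α-1) E_{α,α}(-(s/τ₀)^α))` for `s > 0`.
Then `τ(s)/s → 1/α` as `s → +∞`; equivalently,
`E_α(-x^α) / (x^α E_{α,α}(-x^α)) → 1/α` as `x → +∞`. In particular,
`τ(s) → +∞` as `s → +∞`. -/
theorem nonlinear_relaxation_time_tendsto_atTop (α τ₀ : ℝ)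
    (hα : α ∈ Set.Ioo (0 : ℝ) 1) (hτ : 0 < τ₀) (τ : ℝ → ℝ)
    (hτf : ∀ s > (0 : ℝ), τ s = τ₀ * mittagLeffler α 1 (-((s / τ₀) ^ α)) /
      ((s / τ₀) ^ (α - 1) * mittagLeffler α α (-((s / τ₀) ^ α)))) :
    Filter.Tendsto (fun s => τ s / s) Filter.atTop (nhds (1 / α)) ∧
    Filter.Tendsto
      (fun x : ℝ => mittagLeffler α 1 (-(x ^ α)) / (x ^ α * mittagLeffler α α (-(x ^ α))))
      Filter.atTop (nhds (1 / α)) ∧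
    Filter.Tendsto τ Filter.atTop Filter.atTop := by
  have h2 : Filter.Tendsto
      (fun x : ℝ => mittagLeffler α 1 (-(x ^ α)) / (x ^ α * mittagLeffler α α (-(x ^ α))))
      Filter.atTop (nhds (1 / α)) :=
    (tendsto_mittagLeffler_ratio hα).comp (tendsto_rpow_atTop hα.1)
  have h1 : Filter.Tendsto (fun s => τ s / s) Filter.atTop (nhds (1 / α)) := by
    refine (h2.comp (Filter.tendsto_id.atTop_div_const hτ)).congr' ?_
    filter_upwards [Filter.eventually_gt_atTop 0] with s hs
    have hx : 0 < s / τ₀ := div_pos hs hτ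
    rw [Function.comp_apply, id_eq, hτf s hs, Real.rpow_sub_one hx.ne']
    field_simp
  refine ⟨h1, h2, ?_⟩
  refine (h1.pos_mul_atTop (one_div_pos.2 hα.1) Filter.tendsto_id).congr' ?_
  filter_upwards [Filter.eventually_gt_atTop 0] with s hs
  exact div_mul_cancel₀ _ hs.ne'
end

section
/- Let α ∈ (0, 1) and let τ₀ > 0, k₀ > 0, and σ₀ ∈ (0, k₀). Then there exists a unique c > 0 such that k₀ E_α(−(c/τ₀)^α) = σ₀. More generally, the map x ↦ E_α(−x^α) is a strictly decreasing bijection from [0, ∞) onto (0, 1]. -/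
open Set Filter Topology MeasureTheory

theorem Real.Gamma_div_Gamma_add_le {α y : ℝ} (hα : α ∈ Ioo (0 : ℝ) 1) (hy : 0 < y) :
    Real.Gamma y / Real.Gamma (y + α) ≤ (y + α) ^ (1 - α) / y := by
  have h0 := hα.1
  have hya : 0 < y + α := by linarith
  have hG : 0 < Real.Gamma (y + α) := Real.Gamma_pos_of_pos hya
  have h := Real.Gamma_mul_add_mul_le_rpow_Gamma_mul_rpow_Gamma (s := y + α) (t := y + α + 1)
    hya (by linarith) h0 (sub_pos.2 hα.2) (by ring)
  rw [show α * (y + α) + (1 - α) * (y + α + 1) = y + 1 by ring, Real.Gamma_add_one hy.ne',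
    Real.Gamma_add_one hya.ne', Real.mul_rpow hya.le hG.le, mul_left_comm,
    ← Real.rpow_add hG, add_sub_cancel, Real.rpow_one] at h
  rw [div_le_div_iff₀ hG hy]
  linarith

theorem Real.tendsto_Gamma_div_Gamma_add {α : ℝ} (hα : α ∈ Ioo (0 : ℝ) 1) :
    Tendsto (fun y : ℝ => Real.Gamma y / Real.Gamma (y + α)) atTop (𝓝 0) := by
  have h0 := hα.1
  have h1 : Tendsto (fun y : ℝ => 2 * y ^ (-α)) atTop (𝓝 0) := by
    simpa using (tendsto_rpow_neg_atTop h0).const_mul 2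
  refine squeeze_zero' ?_ ?_ h1
  · filter_upwards [eventually_gt_atTop 0] with y hy
    have := Real.Gamma_pos_of_pos hy
    have := Real.Gamma_pos_of_pos (add_pos hy h0)
    positivity
  · filter_upwards [eventually_ge_atTop 1] with y hy
    have hy0 : 0 < y := by linarith
    refine (Real.Gamma_div_Gamma_add_le hα hy0).trans ?_
    have h2 : (y + α) ^ (1 - α) ≤ (2 * y) ^ (1 - α) :=
      Real.rpow_le_rpow (by linarith) (by linarith [hα.2]) (by linarith [hα.2])
    have h3 : (2 : ℝ) ^ (1 - α) ≤ 2 := by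
      simpa using Real.rpow_le_rpow_of_exponent_le (x := 2) (by norm_num)
        (show 1 - α ≤ 1 by linarith)
    rw [Real.mul_rpow (by norm_num) hy0.le] at h2
    rw [div_le_iff₀ hy0, mul_assoc, ← Real.rpow_add_one hy0.ne', neg_add_eq_sub]
    exact h2.trans (by gcongr)

theorem Gamma_coeff_pos {α β : ℝ} (hα : 0 < α) (hβ : 0 < β) (k : ℕ) :
    0 < Real.Gamma (α * k + β) := Real.Gamma_pos_of_pos (by positivity)

theorem summable_mittagLeffler {α β : ℝ} (hα : α ∈ Ioo (0 : ℝ) 1) (hβ : 0 < β) (x : ℝ) :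
    Summable fun k : ℕ => x ^ k / Real.Gamma (α * k + β) := by
  rcases eq_or_ne x 0 with rfl | hx
  · refine summable_of_ne_finset_zero (s := {0}) fun k hk => ?_
    simp_all
  have hΓ := Gamma_coeff_pos hα.1 hβ
  refine summable_of_ratio_test_tendsto_lt_one zero_lt_one
    (Eventually.of_forall fun k => div_ne_zero (pow_ne_zero _ hx) (hΓ k).ne') ?_
  have h1 : Tendsto (fun k : ℕ => α * k + β) atTop atTop :=
    tendsto_atTop_add_const_right _ _ (tendsto_natCast_atTop_atTop.const_mul_atTop hα.1)
  have h2 := ((Real.tendsto_Gamma_div_Gamma_add hα).comp h1).const_mul |x|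
  rw [mul_zero] at h2
  refine h2.congr fun k => ?_
  have h3 := hΓ (k + 1)
  have h4 := hΓ k
  have hx' : 0 < |x| := abs_pos.2 hx
  rw [norm_div, norm_div, norm_pow, norm_pow, Real.norm_of_nonneg h3.le,
    Real.norm_of_nonneg h4.le, Real.norm_eq_abs, Function.comp_apply,
    show α * (k : ℝ) + β + α = α * (k + 1 : ℕ) + β by push_cast; ring, pow_succ]
  field_simp

theorem mittagLeffler_eq_add {α β : ℝ} (hα : α ∈ Ioo (0 : ℝ) 1) (hβ : 0 < β) (x : ℝ) :
    mittagLeffler α β x = 1 / Real.Gamma β + x * mittagLeffler α (β + α) x := by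
  rw [mittagLeffler, (summable_mittagLeffler hα hβ x).tsum_eq_zero_add, mittagLeffler,
    ← tsum_mul_left]
  congr 1
  · simp
  · refine tsum_congr fun k => ?_
    rw [show α * ((k + 1 : ℕ) : ℝ) + β = α * k + (β + α) by push_cast; ring, pow_succ]
    ring

theorem mittagLeffler_zero {α β : ℝ} (hα : α ∈ Ioo (0 : ℝ) 1) (hβ : 0 < β) :
    mittagLeffler α β 0 = 1 / Real.Gamma β := by
  rw [mittagLeffler_eq_add hα hβ]; simp

theorem hasDerivAt_mittagLeffler {α β : ℝ} (hα : α ∈ Ioo (0 : ℝ) 1) (hβ : 0 < β) (x : ℝ) :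
    HasDerivAt (mittagLeffler α β) (∑' k : ℕ, k * x ^ (k - 1) / Real.Gamma (α * k + β)) x := by
  have hΓ := Gamma_coeff_pos hα.1 hβ
  set R : ℝ := |x| + 1 with hR
  have hR1 : 1 ≤ R := by have := abs_nonneg x; linarith
  refine hasDerivAt_tsum_of_isPreconnected (t := Metric.ball 0 R) (y₀ := x)
    (g := fun (k : ℕ) x => x ^ k / Real.Gamma (α * k + β))
    (g' := fun (k : ℕ) x => k * x ^ (k - 1) / Real.Gamma (α * k + β))
    (summable_mittagLeffler hα hβ (2 * R)) Metric.isOpen_ball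
    (convex_ball 0 R).isPreconnected (fun k y _ => ?_) (fun k y hy => ?_) ?_
    (summable_mittagLeffler hα hβ x) ?_
  · exact (hasDerivAt_pow k y).div_const _
  · have hy' : |y| ≤ R := by simpa using (mem_ball_zero_iff.1 hy).le
    rw [norm_div, norm_mul, norm_pow, Real.norm_of_nonneg (hΓ k).le, Real.norm_eq_abs,
      Real.norm_eq_abs, Nat.abs_cast, mul_pow]
    have h1 : (k : ℝ) ≤ 2 ^ k := by exact_mod_cast Nat.lt_two_pow_self.le
    have h2 : |y| ^ (k - 1) ≤ R ^ k :=
      (pow_le_pow_left₀ (abs_nonneg y) hy' _).trans (pow_le_pow_right₀ hR1 (Nat.sub_le _ _))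
    have := hΓ k
    gcongr
  all_goals simp [hR]

theorem continuous_mittagLeffler {α β : ℝ} (hα : α ∈ Ioo (0 : ℝ) 1) (hβ : 0 < β) :
    Continuous (mittagLeffler α β) :=
  continuous_iff_continuousAt.2 fun x => (hasDerivAt_mittagLeffler hα hβ x).continuousAt

theorem hasDerivAt_mittagLeffler_one {α : ℝ} (hα : α ∈ Ioo (0 : ℝ) 1) (x : ℝ) :
    HasDerivAt (mittagLeffler α 1) (mittagLeffler α α x / α) x := by
  have h0 := hα.1
  have hterm (k : ℕ) : ((k + 1 : ℕ) : ℝ) * x ^ (k + 1 - 1) / Real.Gamma (α * (k + 1 : ℕ) + 1) =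
      x ^ k / Real.Gamma (α * k + α) / α := by
    have := Gamma_coeff_pos h0 h0 k
    rw [Real.Gamma_add_one (by positivity),
      show α * ((k + 1 : ℕ) : ℝ) = α * k + α by push_cast; ring, Nat.add_sub_cancel]
    push_cast
    field_simp
  convert hasDerivAt_mittagLeffler hα one_pos x using 1
  have hs : Summable fun k : ℕ => (k : ℝ) * x ^ (k - 1) / Real.Gamma (α * k + 1) := by
    rw [← summable_nat_add_iff 1]
    simp_rw [hterm]
    exact (summable_mittagLeffler hα h0 x).div_const α
  rw [hs.tsum_eq_zero_add]
  simp_rw [hterm]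
  rw [tsum_div_const]
  simp [mittagLeffler]

theorem integral_rpow_mul_sub_rpow {u v t : ℝ} (hu : 0 < u) (hv : 0 < v) (ht : 0 < t) :
    ∫ s in 0..t, s ^ (u - 1) * (t - s) ^ (v - 1) =
      Real.Gamma u * Real.Gamma v / Real.Gamma (u + v) * t ^ (u + v - 1) := by
  have h := Complex.betaIntegral_scaled u v ht
  rw [Complex.betaIntegral_eq_Gamma_mul_div u v (by simpa) (by simpa)] at h
  have h2 : ∫ x in 0..t, (x : ℂ) ^ ((u : ℂ) - 1) * ((t : ℂ) - x) ^ ((v : ℂ) - 1) =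
      ((∫ s in 0..t, s ^ (u - 1) * (t - s) ^ (v - 1) : ℝ) : ℂ) := by
    rw [← intervalIntegral.integral_ofReal]
    refine intervalIntegral.integral_congr fun s hs => ?_
    rw [uIcc_of_le ht.le] at hs
    push_cast [Complex.ofReal_cpow hs.1, Complex.ofReal_cpow (sub_nonneg.2 hs.2)]
    rfl
  rw [h2, ← Complex.ofReal_add, Complex.Gamma_ofReal, Complex.Gamma_ofReal,
    Complex.Gamma_ofReal, ← Complex.ofReal_one, ← Complex.ofReal_sub,
    ← Complex.ofReal_cpow ht.le] at h
  have h3 : ((∫ s in 0..t, s ^ (u - 1) * (t - s) ^ (v - 1) : ℝ) : ℂ) =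
      ((t ^ (u + v - 1) * (Real.Gamma u * Real.Gamma v / Real.Gamma (u + v)) : ℝ) : ℂ) := by
    rw [h]; push_cast; rfl
  rw [Complex.ofReal_injective h3, mul_comm]

theorem intervalIntegrable_rpow_mul_sub_rpow {u v t : ℝ} (hu : 0 < u) (hv : 0 < v)
    (ht : 0 < t) :
    IntervalIntegrable (fun s => s ^ (u - 1) * (t - s) ^ (v - 1)) volume 0 t := by
  by_contra h
  have h1 := integral_rpow_mul_sub_rpow hu hv ht
  rw [intervalIntegral.integral_undef h] at h1
  have := Real.Gamma_pos_of_pos hu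
  have := Real.Gamma_pos_of_pos hv
  have := Real.Gamma_pos_of_pos (add_pos hu hv)
  have : 0 < Real.Gamma u * Real.Gamma v / Real.Gamma (u + v) * t ^ (u + v - 1) := by positivity
  linarith

theorem integral_rpow_mul_sub_rpow_mul_mittagLeffler {α β γ c t : ℝ} (hα : α ∈ Ioo (0 : ℝ) 1)
    (hβ : 0 < β) (hγ : 0 < γ) (ht : 0 < t) :
    ∫ s in 0..t, s ^ (β - 1) * (t - s) ^ (γ - 1) * mittagLeffler α β (c * s ^ α) =
      Real.Gamma γ * t ^ (β + γ - 1) * mittagLeffler α (β + γ) (c * t ^ α) := by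
  have h0 := hα.1
  have hker := intervalIntegrable_rpow_mul_sub_rpow hβ hγ ht
  let F : ℕ → ℝ → ℝ := fun k s =>
    s ^ (β - 1) * (t - s) ^ (γ - 1) * ((c * s ^ α) ^ k / Real.Gamma (α * k + β))
  have hcont (k : ℕ) : Continuous fun s : ℝ => (c * s ^ α) ^ k / Real.Gamma (α * k + β) := by
    have := Real.continuous_rpow_const h0.le
    fun_prop
  have hF : HasSum (fun k => ∫ s in 0..t, F k s)
      (∫ s in 0..t, s ^ (β - 1) * (t - s) ^ (γ - 1) * mittagLeffler α β (c * s ^ α)) := by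
    refine intervalIntegral.hasSum_integral_of_dominated_convergence
      (fun k s => s ^ (β - 1) * (t - s) ^ (γ - 1) *
        ((|c| * t ^ α) ^ k / Real.Gamma (α * k + β))) (fun k => ?_) (fun k => ?_) ?_ ?_ ?_
    · rw [uIoc_of_le ht.le]
      exact (hker.mul_continuousOn (hcont k).continuousOn).1.aestronglyMeasurable
    · refine Eventually.of_forall fun s hs => ?_
      rw [uIoc_of_le ht.le] at hs
      have h1 : 0 ≤ s ^ (β - 1) * (t - s) ^ (γ - 1) :=
        mul_nonneg (Real.rpow_nonneg hs.1.le _) (Real.rpow_nonneg (sub_nonneg.2 hs.2) _)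
      rw [norm_mul, Real.norm_of_nonneg h1, norm_div, norm_pow, norm_mul,
        Real.norm_of_nonneg (Gamma_coeff_pos h0 hβ k).le, Real.norm_eq_abs,
        Real.norm_of_nonneg (Real.rpow_nonneg hs.1.le _)]
      have := Gamma_coeff_pos h0 hβ k
      have := Real.rpow_nonneg hs.1.le α
      have := Real.rpow_le_rpow hs.1.le hs.2 h0.le
      gcongr
    · exact Eventually.of_forall fun s _ => (summable_mittagLeffler hα hβ _).mul_left _
    · simp_rw [tsum_mul_left]
      exact hker.mul_const _
    · exact Eventually.of_forall fun s _ => (summable_mittagLeffler hα hβ _).hasSum.mul_left _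
  rw [← hF.tsum_eq, mittagLeffler, ← tsum_mul_left]
  refine tsum_congr fun k => ?_
  have hk : 0 < α * k + β := by positivity
  have h1 : ∫ s in 0..t, F k s = ∫ s in 0..t, c ^ k / Real.Gamma (α * k + β) *
      (s ^ (α * k + β - 1) * (t - s) ^ (γ - 1)) := by
    refine intervalIntegral.integral_congr_ae (Eventually.of_forall fun s hs => ?_)
    rw [uIoc_of_le ht.le] at hs
    simp only [F]
    rw [mul_pow, ← Real.rpow_mul_natCast hs.1.le, add_sub_assoc, Real.rpow_add hs.1]
    ring
  rw [h1, intervalIntegral.integral_const_mul, integral_rpow_mul_sub_rpow hk hγ ht, mul_pow,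
    ← Real.rpow_mul_natCast ht.le, show α * (k : ℝ) + β + γ - 1 = α * k + (β + γ - 1) by ring,
    Real.rpow_add ht, ← add_assoc]
  have := Real.Gamma_pos_of_pos hk
  field_simp

theorem one_sub_rpow_add_le {α s t : ℝ} (hα : α ∈ Ioo (0 : ℝ) 1) (hs : 0 ≤ s) (hst : s < t)
    (ht : t < 1) :
    (1 - s) ^ (α - 1) + (1 - α) * (s * (1 - t)) ≤ t ^ (1 - α) * (t - s) ^ (α - 1) := by
  have ht0 : 0 < t := by linarith
  have hs1 : 0 < 1 - s := by linarith
  have hts : 0 < t - s := by linarith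
  have hα1 : 0 < 1 - α := sub_pos.2 hα.2
  set ρ : ℝ := (t - s) / (t * (1 - s)) with hρ
  have hρ0 : 0 < ρ := by positivity
  have h1 : s * (1 - t) ≤ 1 - ρ := by
    have h2 : 1 - ρ = s * (1 - t) / (t * (1 - s)) := by rw [hρ]; field_simp; ring
    rw [h2, le_div_iff₀ (by positivity)]
    have h3 : 0 ≤ s * (1 - t) := mul_nonneg hs (by linarith)
    exact mul_le_of_le_one_right h3 (mul_le_one₀ ht.le hs1.le (by linarith))
  have h2 : 1 + (1 - α) * (s * (1 - t)) ≤ ρ ^ (α - 1) := by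
    rw [Real.rpow_def_of_pos hρ0]
    have h4 := Real.add_one_le_exp (Real.log ρ * (α - 1))
    have h5 := Real.log_le_sub_one_of_pos hρ0
    nlinarith
  have h3 : t ^ (1 - α) * (t - s) ^ (α - 1) = (1 - s) ^ (α - 1) * ρ ^ (α - 1) := by
    rw [← Real.mul_rpow hs1.le hρ0.le, ← neg_sub α 1, Real.rpow_neg_eq_inv_rpow,
      ← Real.mul_rpow (by positivity) hts.le, hρ]
    congr 1
    field_simp
  have h4 : 1 ≤ (1 - s) ^ (α - 1) :=
    Real.one_le_rpow_of_pos_of_le_one_of_nonpos hs1 (by linarith) (by linarith)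
  have h5 : 0 ≤ (1 - α) * (s * (1 - t)) :=
    mul_nonneg hα1.le (mul_nonneg hs (by linarith))
  rw [h3]
  nlinarith

/-- If `h` is positive on `[0, 1)` and vanishes at least linearly at `1`, then the normalised
convolution `t ^ (1 - α) * ∫ s in 0..t, (t - s) ^ (α - 1) * (s ^ (α - 1) * h s)` exceeds its
value at `1` somewhere on `(0, 1)`. -/
theorem exists_convolution_lt {α C : ℝ} (hα : α ∈ Ioo (0 : ℝ) 1) {h : ℝ → ℝ}
    (hc : Continuous h) (hpos : ∀ s ∈ Ico (0 : ℝ) 1, 0 < h s) (hC : 0 < C)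
    (hlin : ∀ᶠ s in 𝓝[<] 1, h s ≤ C * (1 - s)) :
    ∃ t ∈ Ioo (0 : ℝ) 1, ∫ s in 0..1, s ^ (α - 1) * (1 - s) ^ (α - 1) * h s <
      t ^ (1 - α) * ∫ s in 0..t, s ^ (α - 1) * (t - s) ^ (α - 1) * h s := by
  have h0 := hα.1
  have hα1 : 0 < 1 - α := sub_pos.2 hα.2
  obtain ⟨z, hz, hzmin⟩ := isCompact_Icc.exists_isMinOn
    (nonempty_Icc.2 (by norm_num : (1 / 4 : ℝ) ≤ 1 / 2)) hc.continuousOn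
  have hm : 0 < h z := hpos z ⟨by linarith [hz.1], by linarith [hz.2]⟩
  set m := h z
  obtain ⟨a, ha, haC⟩ := mem_nhdsLT_iff_exists_Ioo_subset.1 hlin
  have hsmall : ∀ᶠ t in 𝓝[<] (1 : ℝ), 2 * C * (1 - t) ^ α < m * (1 - α) / 16 := by
    have hcont : Continuous fun t : ℝ => 2 * C * (1 - t) ^ α := by
      have := Real.continuous_rpow_const h0.le
      fun_prop
    refine (hcont.tendsto 1).mono_left nhdsWithin_le_nhds |>.eventually_lt_const ?_
    simp only [sub_self, Real.zero_rpow h0.ne', mul_zero]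
    positivity
  obtain ⟨t, hts, hta, ht1⟩ := (hsmall.and (Ioo_mem_nhdsLT
    (max_lt ha (by norm_num : (1 / 2 : ℝ) < 1)))).exists
  have hta' : a < t := (le_max_left _ _).trans_lt hta
  have ht2 : 1 / 2 < t := (le_max_right _ _).trans_lt hta
  have ht0 : 0 < t := by linarith
  refine ⟨t, ⟨ht0, ht1⟩, ?_⟩
  have hi1 : IntervalIntegrable (fun s => s ^ (α - 1) * (1 - s) ^ (α - 1) * h s) volume 0 1 :=
    (intervalIntegrable_rpow_mul_sub_rpow h0 h0 one_pos).mul_continuousOn hc.continuousOn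
  have hit : IntervalIntegrable (fun s => s ^ (α - 1) * (t - s) ^ (α - 1) * h s) volume 0 t :=
    (intervalIntegrable_rpow_mul_sub_rpow h0 h0 ht0).mul_continuousOn hc.continuousOn
  have hi0t : IntervalIntegrable (fun s => s ^ (α - 1) * (1 - s) ^ (α - 1) * h s) volume 0 t :=
    hi1.mono_set (by
      rw [uIcc_of_le ht0.le, uIcc_of_le zero_le_one]; exact Icc_subset_Icc_right ht1.le)
  have hit1 : IntervalIntegrable (fun s => s ^ (α - 1) * (1 - s) ^ (α - 1) * h s) volume t 1 :=
    hi1.mono_set (by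
      rw [uIcc_of_le ht1.le, uIcc_of_le zero_le_one]; exact Icc_subset_Icc_left ht0.le)
  have htail : ∫ s in t..1, s ^ (α - 1) * (1 - s) ^ (α - 1) * h s ≤
      2 * C * (1 - t) ^ α * (1 - t) := by
    have h2 : ∫ s in t..1, s ^ (α - 1) * (1 - s) ^ (α - 1) * h s ≤
        ∫ s in t..1, 2 * C * (1 - t) ^ α := by
      refine intervalIntegral.integral_mono_on_of_le_Ioo ht1.le hit1
        intervalIntegrable_const fun s hs => ?_
      have hs0 : 0 < s := ht0.trans hs.1
      have hs1 : 0 < 1 - s := by linarith [hs.2]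
      have e1 : s ^ (α - 1) ≤ 2 := by
        have e2 := Real.rpow_le_rpow_of_exponent_ge hs0 hs.2.le (by linarith : (-1 : ℝ) ≤ α - 1)
        rw [Real.rpow_neg_one] at e2
        refine e2.trans (inv_le_of_inv_le₀ (by norm_num) ?_)
        linarith [hs.1]
      have e3 : (1 - s) ^ (α - 1) * h s ≤ C * (1 - t) ^ α := calc
        (1 - s) ^ (α - 1) * h s ≤ (1 - s) ^ (α - 1) * (C * (1 - s)) := by
          have : h s ≤ C * (1 - s) := haC ⟨hta'.trans hs.1, hs.2⟩
          gcongr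
        _ = C * (1 - s) ^ α := by
          rw [mul_left_comm, ← Real.rpow_add_one hs1.ne', sub_add_cancel]
        _ ≤ C * (1 - t) ^ α := by
          have := hs.1
          gcongr
      have e4 : 0 ≤ (1 - s) ^ (α - 1) * h s :=
        mul_nonneg (Real.rpow_nonneg hs1.le _) (hpos s ⟨hs0.le, hs.2⟩).le
      calc s ^ (α - 1) * (1 - s) ^ (α - 1) * h s = s ^ (α - 1) * ((1 - s) ^ (α - 1) * h s) := by
            ring
        _ ≤ 2 * (C * (1 - t) ^ α) := by gcongr
        _ = _ := by ring
    rw [intervalIntegral.integral_const, smul_eq_mul, mul_comm] at h2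
    exact h2
  have hgain : m * (1 - α) / 16 * (1 - t) ≤
      (t ^ (1 - α) * ∫ s in 0..t, s ^ (α - 1) * (t - s) ^ (α - 1) * h s) -
        ∫ s in 0..t, s ^ (α - 1) * (1 - s) ^ (α - 1) * h s := by
    rw [← intervalIntegral.integral_const_mul,
      ← intervalIntegral.integral_sub (hit.const_mul _) hi0t]
    have hD := (hit.const_mul (t ^ (1 - α))).sub hi0t
    have hlow : ∀ s ∈ Ioo 0 t, (1 - α) * (s * (1 - t)) * (s ^ (α - 1) * h s) ≤
        t ^ (1 - α) * (s ^ (α - 1) * (t - s) ^ (α - 1) * h s) -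
          s ^ (α - 1) * (1 - s) ^ (α - 1) * h s := fun s hs => by
      have e1 := one_sub_rpow_add_le hα hs.1.le hs.2 ht1
      have e2 : 0 ≤ s ^ (α - 1) * h s :=
        mul_nonneg (Real.rpow_nonneg hs.1.le _) (hpos s ⟨hs.1.le, hs.2.trans ht1⟩).le
      have e3 := mul_le_mul_of_nonneg_right e1 e2
      linarith
    have hnn : ∀ s ∈ Ioo 0 t, 0 ≤ t ^ (1 - α) * (s ^ (α - 1) * (t - s) ^ (α - 1) * h s) -
          s ^ (α - 1) * (1 - s) ^ (α - 1) * h s := fun s hs => by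
      refine le_trans ?_ (hlow s hs)
      have := hpos s ⟨hs.1.le, hs.2.trans ht1⟩
      have := hs.1
      have : 0 < 1 - t := by linarith
      positivity
    have hsub : ∫ s in (1 / 4 : ℝ)..(1 / 2), m * (1 - α) / 4 * (1 - t) ≤
        ∫ s in (1 / 4 : ℝ)..(1 / 2),
          (t ^ (1 - α) * (s ^ (α - 1) * (t - s) ^ (α - 1) * h s) -
            s ^ (α - 1) * (1 - s) ^ (α - 1) * h s) := by
      refine intervalIntegral.integral_mono_on (by norm_num) intervalIntegrable_const
        (hD.mono_set ?_) fun s hs => ?_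
      · rw [uIcc_of_le (by norm_num), uIcc_of_le ht0.le]
        exact Icc_subset_Icc (by norm_num) ht2.le
      · have hs0 : 0 < s := by linarith [hs.1]
        refine le_trans ?_ (hlow s ⟨hs0, by linarith [hs.2]⟩)
        have e1 : 1 ≤ s ^ (α - 1) := Real.one_le_rpow_of_pos_of_le_one_of_nonpos hs0
          (by linarith [hs.2]) (by linarith)
        have e2 : m ≤ h s := hzmin hs
        have e3 : 0 < 1 - t := by linarith
        have e4 : m ≤ s ^ (α - 1) * h s := by nlinarith
        calc m * (1 - α) / 4 * (1 - t) = (1 - α) * (1 / 4 * (1 - t)) * m := by ring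
          _ ≤ _ := by
            have := hs.1
            gcongr
    have hmono := intervalIntegral.integral_mono_interval (μ := volume) (c := 0) (d := t)
      (by norm_num : (0 : ℝ) ≤ 1 / 4) (by norm_num : (1 / 4 : ℝ) ≤ 1 / 2) ht2.le ?_ hD
    · rw [intervalIntegral.integral_const, smul_eq_mul] at hsub
      linarith
    · rw [← restrict_Ioo_eq_restrict_Ioc]
      exact (ae_restrict_iff' measurableSet_Ioo).2 (Eventually.of_forall hnn)
  have hsplit := intervalIntegral.integral_add_adjacent_intervals hi0t hit1
  have := mul_lt_mul_of_pos_right hts (sub_pos.2 ht1)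
  linarith

theorem rpow_mul_integral_mittagLeffler_self {α c t : ℝ} (hα : α ∈ Ioo (0 : ℝ) 1)
    (ht : 0 < t) :
    c * (t ^ (1 - α) *
      ∫ s in 0..t, s ^ (α - 1) * (t - s) ^ (α - 1) * mittagLeffler α α (c * s ^ α)) =
    Real.Gamma α * mittagLeffler α α (c * t ^ α) - 1 := by
  have hΓ := Real.Gamma_pos_of_pos hα.1
  rw [integral_rpow_mul_sub_rpow_mul_mittagLeffler hα hα.1 hα.1 ht,
    mittagLeffler_eq_add hα hα.1 (c * t ^ α)]
  have h1 : t ^ (1 - α) * t ^ (α + α - 1) = t ^ α := by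
    rw [← Real.rpow_add ht]; congr 1; ring
  rw [← h1]
  field_simp
  ring

theorem mittagLeffler_self_neg_pos {α x : ℝ} (hα : α ∈ Ioo (0 : ℝ) 1) (hx : 0 ≤ x) :
    0 < mittagLeffler α α (-x) := by
  have h0 := hα.1
  have hΓ := Real.Gamma_pos_of_pos h0
  have hcont := continuous_mittagLeffler hα h0
  by_contra! hneg
  set S : Set ℝ := Ici 0 ∩ {y | mittagLeffler α α (-y) ≤ 0}
  have hSc : IsClosed S := isClosed_Ici.inter
    (isClosed_le (hcont.comp continuous_neg) continuous_const)
  have hSb : BddBelow S := ⟨0, fun y hy => hy.1⟩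
  obtain ⟨hz0, hz⟩ := hSc.csInf_mem ⟨x, hx, hneg⟩ hSb
  have hlt : ∀ y, 0 ≤ y → y < sInf S → 0 < mittagLeffler α α (-y) := fun y hy hyz => by
    by_contra! h
    exact (csInf_le hSb ⟨hy, h⟩).not_gt hyz
  set z := sInf S
  rw [mem_ofPred_eq] at hz
  have hzpos : 0 < z := by
    refine lt_of_le_of_ne hz0 fun h => ?_
    rw [← h, neg_zero, mittagLeffler_zero hα h0] at hz
    have : 0 < 1 / Real.Gamma α := by positivity
    linarith
  set h : ℝ → ℝ := fun s => mittagLeffler α α (-z * s ^ α) with hh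
  have hhc : Continuous h := by
    have := Real.continuous_rpow_const h0.le
    fun_prop
  have hpos : ∀ s ∈ Ico (0 : ℝ) 1, 0 < h s := fun s hs => by
    have e1 : s ^ α < 1 := Real.rpow_lt_one hs.1 hs.2 h0
    have e2 : 0 ≤ s ^ α := Real.rpow_nonneg hs.1 _
    simp only [hh, neg_mul]
    exact hlt _ (by positivity) (by nlinarith)
  have hh1 : h 1 ≤ 0 := by simpa [hh] using hz
  have hdiff : DifferentiableAt ℝ h 1 := by
    refine DifferentiableAt.comp (g := mittagLeffler α α) 1
      (hasDerivAt_mittagLeffler hα h0 _).differentiableAt ?_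
    exact (Real.differentiableAt_rpow_const_of_ne α one_ne_zero).const_mul _
  obtain ⟨C, hC, hbound⟩ := hdiff.isBigO_sub.exists_pos
  have hlin : ∀ᶠ s in 𝓝[<] 1, h s ≤ C * (1 - s) := by
    filter_upwards [hbound.bound.filter_mono nhdsWithin_le_nhds, self_mem_nhdsWithin]
      with s hs hs1
    have e1 : ‖s - 1‖ = 1 - s := by
      rw [Real.norm_eq_abs, abs_sub_comm, abs_of_pos (sub_pos.2 hs1)]
    rw [e1] at hs
    linarith [Real.le_norm_self (h s - h 1)]
  obtain ⟨t, ht, hlt'⟩ := exists_convolution_lt hα hhc hpos hC hlin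
  have e1 := rpow_mul_integral_mittagLeffler_self (c := -z) hα one_pos
  have e2 := rpow_mul_integral_mittagLeffler_self (c := -z) hα ht.1
  have e3 : 0 < Real.Gamma α * h t := mul_pos hΓ (hpos t ⟨ht.1.le, ht.2⟩)
  have e4 : Real.Gamma α * h 1 ≤ 0 := mul_nonpos_of_nonneg_of_nonpos hΓ.le hh1
  have e5 := mul_lt_mul_of_pos_left hlt' hzpos
  simp only [Real.one_rpow, one_mul, hh] at e1 e2 e3 e4 e5
  linarith

theorem strictAntiOn_mittagLeffler_neg {α : ℝ} (hα : α ∈ Ioo (0 : ℝ) 1) :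
    StrictAntiOn (fun x => mittagLeffler α 1 (-x)) (Ici 0) := by
  have hd (x : ℝ) := (hasDerivAt_mittagLeffler_one hα (-x)).comp x (hasDerivAt_neg x)
  refine strictAntiOn_of_deriv_neg (convex_Ici 0)
    (fun x _ => (hd x).continuousAt.continuousWithinAt) fun x hx => ?_
  rw [interior_Ici] at hx
  rw [show deriv (fun x => mittagLeffler α 1 (-x)) x = _ from (hd x).deriv]
  have := div_pos (mittagLeffler_self_neg_pos hα (le_of_lt hx)) hα.1
  linarith

theorem mittagLeffler_neg_pos {α x : ℝ} (hα : α ∈ Ioo (0 : ℝ) 1) (hx : 0 ≤ x) :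
    0 < mittagLeffler α 1 (-x) := by
  have h0 := hα.1
  have hα1 : 0 < 1 - α := sub_pos.2 hα.2
  have h := integral_rpow_mul_sub_rpow_mul_mittagLeffler (c := -x) hα h0 hα1 one_pos
  simp only [Real.one_rpow, mul_one, add_sub_cancel] at h
  have hpos : 0 < ∫ s in (0 : ℝ)..1,
      s ^ (α - 1) * (1 - s) ^ (1 - α - 1) * mittagLeffler α α (-x * s ^ α) := by
    refine intervalIntegral.intervalIntegral_pos_of_pos_on ?_ (fun s hs => ?_) one_pos
    · refine (intervalIntegrable_rpow_mul_sub_rpow h0 hα1 one_pos).mul_continuousOn ?_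
      have := continuous_mittagLeffler hα h0
      have := Real.continuous_rpow_const h0.le
      fun_prop
    · have e1 : 0 < s := hs.1
      have e2 : 0 < 1 - s := sub_pos.2 hs.2
      have e3 : 0 < mittagLeffler α α (-x * s ^ α) := by
        rw [neg_mul]; exact mittagLeffler_self_neg_pos hα (by positivity)
      positivity
  rw [h] at hpos
  exact (pos_iff_pos_of_mul_pos hpos).1 (Real.Gamma_pos_of_pos hα1)

theorem mittagLeffler_neg_mul_le {α x : ℝ} (hα : α ∈ Ioo (0 : ℝ) 1) (hx : 0 ≤ x) :
    mittagLeffler α 1 (-x) * (1 + x / Real.Gamma (1 + α)) ≤ 1 := by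
  have h0 := hα.1
  have hΓ := Real.Gamma_pos_of_pos h0
  have h := integral_rpow_mul_sub_rpow_mul_mittagLeffler (c := -x) hα one_pos h0 one_pos
  have hker := intervalIntegrable_rpow_mul_sub_rpow one_pos h0 one_pos
  have hB := integral_rpow_mul_sub_rpow one_pos h0 one_pos
  have hmono : ∫ s in (0 : ℝ)..1, s ^ ((1 : ℝ) - 1) * (1 - s) ^ (α - 1) *
      mittagLeffler α 1 (-x) ≤ ∫ s in (0 : ℝ)..1, s ^ ((1 : ℝ) - 1) * (1 - s) ^ (α - 1) *
      mittagLeffler α 1 (-x * s ^ α) := by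
    refine intervalIntegral.integral_mono_on zero_le_one (hker.mul_const _)
      (hker.mul_continuousOn ?_) fun s hs => ?_
    · have := continuous_mittagLeffler hα one_pos
      have := Real.continuous_rpow_const h0.le
      fun_prop
    · have e1 : 0 ≤ s ^ α := Real.rpow_nonneg hs.1 _
      have e2 : s ^ α ≤ 1 := Real.rpow_le_one hs.1 hs.2 h0.le
      have e3 := Real.rpow_nonneg hs.1 ((1 : ℝ) - 1)
      have e4 := Real.rpow_nonneg (sub_nonneg.2 hs.2) (α - 1)
      have e5 : mittagLeffler α 1 (-x) ≤ mittagLeffler α 1 (-x * s ^ α) := by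
        rw [neg_mul]
        exact (strictAntiOn_mittagLeffler_neg hα).antitoneOn (mul_nonneg hx e1) hx
          (mul_le_of_le_one_right hx e2)
      gcongr
  rw [h, intervalIntegral.integral_mul_const, hB] at hmono
  simp only [Real.one_rpow, mul_one, Real.Gamma_one, one_mul] at hmono
  have h1 := mittagLeffler_eq_add hα one_pos (-x)
  rw [Real.Gamma_one, div_one] at h1
  have hle : mittagLeffler α 1 (-x) / Real.Gamma (1 + α) ≤ mittagLeffler α (1 + α) (-x) := by
    refine le_of_mul_le_mul_left ?_ hΓ
    rwa [← mul_div_assoc, mul_div_right_comm]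
  have h2 := mul_le_mul_of_nonneg_left hle hx
  calc mittagLeffler α 1 (-x) * (1 + x / Real.Gamma (1 + α)) =
        mittagLeffler α 1 (-x) + x * (mittagLeffler α 1 (-x) / Real.Gamma (1 + α)) := by ring
    _ ≤ 1 := by linarith

theorem bijOn_mittagLeffler_neg {α : ℝ} (hα : α ∈ Ioo (0 : ℝ) 1) :
    BijOn (fun x => mittagLeffler α 1 (-x)) (Ici 0) (Ioc 0 1) := by
  have hanti := strictAntiOn_mittagLeffler_neg hα
  have hzero : mittagLeffler α 1 (-0) = 1 := by
    rw [neg_zero, mittagLeffler_zero hα one_pos, Real.Gamma_one, div_one]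
  refine ⟨fun x hx => ⟨mittagLeffler_neg_pos hα hx, ?_⟩, hanti.injOn, fun y hy => ?_⟩
  · exact (hanti.antitoneOn self_mem_Ici hx hx).trans_eq hzero
  · have hΓ : 0 < Real.Gamma (1 + α) := Real.Gamma_pos_of_pos (by linarith [hα.1])
    have hy0 := hy.1
    have hX : 0 ≤ Real.Gamma (1 + α) / y := by positivity
    have hle := mittagLeffler_neg_mul_le hα hX
    have hpos := mittagLeffler_neg_pos hα hX
    have hlt : mittagLeffler α 1 (-(Real.Gamma (1 + α) / y)) ≤ y := by
      have e : 1 + Real.Gamma (1 + α) / y / Real.Gamma (1 + α) = 1 + y⁻¹ := by field_simp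
      rw [e] at hle
      have : mittagLeffler α 1 (-(Real.Gamma (1 + α) / y)) * y⁻¹ ≤ 1 := by linarith
      rwa [← div_eq_mul_inv, div_le_one hy0] at this
    obtain ⟨w, hw, hwy⟩ := intermediate_value_Icc' hX
      ((continuous_mittagLeffler hα one_pos).comp continuous_neg).continuousOn
      ⟨hlt, hy.2.trans_eq hzero.symm⟩
    exact ⟨w, hw.1, hwy⟩

theorem bijOn_rpow_Ici {α : ℝ} (hα : 0 < α) :
    BijOn (fun x : ℝ => x ^ α) (Ici 0) (Ici 0) :=
  ⟨fun _ hx => Real.rpow_nonneg hx _, (Real.strictMonoOn_rpow_Ici_of_exponent_pos hα).injOn,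
    fun y hy => ⟨y ^ α⁻¹, Real.rpow_nonneg hy _, Real.rpow_inv_rpow hy hα.ne'⟩⟩

/-- Let `α ∈ (0,1)`, `τ₀ > 0`, `k₀ > 0`, and `σ₀ ∈ (0, k₀)`. Then there exists a
unique `c > 0` with `k₀ E_α(-(c/τ₀)^α) = σ₀`. More generally, `x ↦ E_α(-x^α)`
is a strictly decreasing bijection from `[0,∞)` onto `(0,1]`. -/
theorem exists_unique_shift (α τ₀ k₀ σ₀ : ℝ) (hα : α ∈ Set.Ioo (0 : ℝ) 1)
    (hτ : 0 < τ₀) (hk : 0 < k₀) (hσ : σ₀ ∈ Set.Ioo 0 k₀) :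
    (∃! c : ℝ, 0 < c ∧ k₀ * mittagLeffler α 1 (-((c / τ₀) ^ α)) = σ₀) ∧
    StrictAntiOn (fun x : ℝ => mittagLeffler α 1 (-(x ^ α))) (Set.Ici 0) ∧
    Set.BijOn (fun x : ℝ => mittagLeffler α 1 (-(x ^ α))) (Set.Ici 0) (Set.Ioc 0 1) := by
  have hbij : BijOn (fun x : ℝ => mittagLeffler α 1 (-(x ^ α))) (Ici 0) (Ioc 0 1) :=
    (bijOn_mittagLeffler_neg hα).comp (bijOn_rpow_Ici hα.1)
  refine ⟨?_, fun x hx y hy hxy => ?_, hbij⟩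
  · obtain ⟨x, hx, hxσ⟩ := hbij.surjOn (⟨div_pos hσ.1 hk, (div_le_one hk).2 hσ.2.le⟩ :
      σ₀ / k₀ ∈ Ioc (0 : ℝ) 1)
    simp only at hxσ
    have hx0 : 0 < x := by
      refine lt_of_le_of_ne hx fun h => ?_
      rw [← h, Real.zero_rpow hα.1.ne', neg_zero, mittagLeffler_zero hα one_pos,
        Real.Gamma_one, div_one, eq_div_iff hk.ne'] at hxσ
      linarith [hσ.2]
    refine ⟨x * τ₀, ⟨by positivity, ?_⟩, fun c hc => ?_⟩
    · rw [mul_div_cancel_right₀ _ hτ.ne', hxσ, mul_div_cancel₀ _ hk.ne']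
    · have hcx : c / τ₀ = x := by
        refine hbij.injOn (div_nonneg hc.1.le hτ.le) hx ?_
        rw [hxσ, eq_div_iff hk.ne', mul_comm]
        exact hc.2
      rw [← hcx, div_mul_cancel₀ _ hτ.ne']
  · exact strictAntiOn_mittagLeffler_neg hα (Real.rpow_nonneg hx _) (Real.rpow_nonneg hy _)
      (Real.rpow_lt_rpow hx hxy hα.1)
end
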